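/- arXiv:1710.04797 — 3 statements merged into one kernel-verified Lean document; each statement's English description precedes it below -/
import Mathlib

section
/- For every i ∈ {1, …, n}, one has B^i(t) = x_{n+i}·x_{n+i−1}·⋯·x_{n+1}·t and B^{n+i}(t) = x_i^{−1}·t, as elements of R_k. -/
/-- The discrete Heisenberg group `H_k` (`k = 2n+1`), realized concretely on
`(Fin n → ℤ) × (Fin n → ℤ) × ℤ`. -/
@[ext]
structure Heis (n : ℕ) where
  a : Fin n → ℤ
  b : Fin n → ℤ
  c : ℤ

namespace Heis

variable {n : ℕ}

instance : Mul (Heis n) :=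
  ⟨fun g h => ⟨g.a + h.a, g.b + h.b, g.c + h.c + ∑ i, g.a i * h.b i⟩⟩

instance : One (Heis n) := ⟨⟨0, 0, 0⟩⟩

instance : Inv (Heis n) :=
  ⟨fun g => ⟨-g.a, -g.b, -g.c + ∑ i, g.a i * g.b i⟩⟩

@[simp] lemma mul_a (g h : Heis n) : (g * h).a = g.a + h.a := rfl
@[simp] lemma mul_b (g h : Heis n) : (g * h).b = g.b + h.b := rfl
@[simp] lemma mul_c (g h : Heis n) :
    (g * h).c = g.c + h.c + ∑ i, g.a i * h.b i := rfl
@[simp] lemma one_a : (1 : Heis n).a = 0 := rfl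
@[simp] lemma one_b : (1 : Heis n).b = 0 := rfl
@[simp] lemma one_c : (1 : Heis n).c = 0 := rfl
@[simp] lemma inv_a (g : Heis n) : g⁻¹.a = -g.a := rfl
@[simp] lemma inv_b (g : Heis n) : g⁻¹.b = -g.b := rfl
@[simp] lemma inv_c (g : Heis n) : g⁻¹.c = -g.c + ∑ i, g.a i * g.b i := rfl

instance : Group (Heis n) where
  mul_assoc g h k := by
    ext <;> simp [Finset.sum_add_distrib, add_mul, mul_add] <;> ring
  one_mul g := by ext <;> simp
  mul_one g := by ext <;> simp
  inv_mul_cancel g := by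
    ext <;> simp [Finset.sum_add_distrib, neg_mul] <;> ring

end Heis

/-- The generators `x_1, …, x_{2n}` of the Heisenberg group: for `1 ≤ i ≤ n`,
`x_i = (e_i, 0, 0)`; for `n+1 ≤ i ≤ 2n`, `x_i = (0, e_{i-n}, 0)`. -/
def xg (n : ℕ) (i : ℕ) : Heis n :=
  if h : 1 ≤ i ∧ i ≤ n then ⟨Pi.single (⟨i - 1, by omega⟩ : Fin n) 1, 0, 0⟩
  else if h' : n + 1 ≤ i ∧ i ≤ 2 * n then
    ⟨0, Pi.single (⟨i - n - 1, by omega⟩ : Fin n) 1, 0⟩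
  else 1

/-- The central element `z = (0,0,1)`. -/
def zz (n : ℕ) : Heis n := ⟨0, 0, 1⟩

/-- The automorphism `t : (a,b,c) ↦ (-a,-b,c)` of the Heisenberg group. -/
def tAut (n : ℕ) : MulAut (Heis n) where
  toFun g := ⟨-g.a, -g.b, g.c⟩
  invFun g := ⟨-g.a, -g.b, g.c⟩
  left_inv g := by ext <;> simp
  right_inv g := by ext <;> simp
  map_mul' g h := by ext <;> simp <;> ring

/-- The subgroup `⟨t⟩` of `Aut(H_k)` generated by `t`. -/
abbrev tsub (n : ℕ) : Subgroup (MulAut (Heis n)) := Subgroup.zpowers (tAut n)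

/-- The group `R_k = H_k ⋊ ⟨t⟩`. -/
abbrev RR (n : ℕ) := SemidirectProduct (Heis n) (tsub n) (tsub n).subtype

/-- The element `t` of `R_k`. -/
def tR (n : ℕ) : RR n := SemidirectProduct.inr ⟨tAut n, Subgroup.mem_zpowers _⟩

/-- The defining conditions for the automorphism `b` of `H_k`. -/
def IsB (n : ℕ) (b : MulAut (Heis n)) : Prop :=
  (∀ i : ℕ, 1 ≤ i → i ≤ n - 1 → b (xg n i) = xg n (i + 1) * xg n (n + 1)) ∧
  (∀ i : ℕ, n ≤ i → i ≤ 2 * n - 1 → b (xg n i) = xg n (i + 1)) ∧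
  b (xg n (2 * n)) =
    (xg n 1)⁻¹ * ((List.range n).map fun j => (xg n (n + 1 + j))⁻¹).prod

/-- The defining conditions for the automorphism `B` of `R_k` extending `b`. -/
def IsBR (n : ℕ) (b : MulAut (Heis n)) (B : MulAut (RR n)) : Prop :=
  (∀ h : Heis n, B (SemidirectProduct.inl h) = SemidirectProduct.inl (b h)) ∧
  B (tR n) = SemidirectProduct.inl (xg n (n + 1)) * tR n

def PP (n i : ℕ) : Heis n := ((List.range i).map fun j => xg n (n + i - j)).prod

lemma PP_succ (n i : ℕ) : PP n (i + 1) = xg n (n + i + 1) * PP n i := by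
  unfold PP
  rw [List.range_succ_eq_map, List.map_cons, List.prod_cons, List.map_map]
  congr 2
  apply List.map_congr_left
  intro j _
  simp only [Function.comp]
  congr 1
  omega

lemma PP_inv (n i : ℕ) :
    ((List.range i).map fun j => (xg n (n + 1 + j))⁻¹).prod = (PP n i)⁻¹ := by
  induction i with
  | zero => simp [PP]
  | succ i ih =>
    rw [List.range_succ, List.map_append, List.prod_append, ih, PP_succ]
    simp [add_right_comm]

lemma b_PP (n : ℕ) (b : MulAut (Heis n)) (hb : IsB n b) (i : ℕ) (hi : i + 1 ≤ n) :
    b (PP n i) * xg n (n + 1) = PP n (i + 1) := by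
  induction i with
  | zero => simp [PP]
  | succ i ih =>
    rw [PP_succ n i, map_mul, mul_assoc, ih (by omega), PP_succ n (i + 1),
      hb.2.1 (n + i + 1) (by omega) (by omega)]
    rfl

lemma xg_comm (n i : ℕ) (h1 : 2 ≤ i) (h2 : i ≤ n) :
    xg n i * xg n (n + 1) = xg n (n + 1) * xg n i := by
  have e1 : xg n i = ⟨Pi.single (⟨i - 1, by omega⟩ : Fin n) 1, 0, 0⟩ := by
    unfold xg; rw [dif_pos ⟨by omega, h2⟩]
  have e2 : xg n (n + 1) = ⟨0, Pi.single (⟨0, by omega⟩ : Fin n) 1, 0⟩ := by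
    unfold xg
    rw [dif_neg (by omega), dif_pos ⟨by omega, by omega⟩]
    simp
  rw [e1, e2]
  ext <;> simp [Pi.single_apply]
  omega

/-- For every `i ∈ {1,…,n}`, `B^i(t) = x_{n+i}·x_{n+i-1}·⋯·x_{n+1}·t` and
`B^{n+i}(t) = x_i⁻¹·t`, as elements of `R_k`. -/
theorem B_power_t (n : ℕ) (hn : 1 ≤ n) (b : MulAut (Heis n)) (hb : IsB n b)
    (B : MulAut (RR n)) (hB : IsBR n b B) :
    ∀ i : ℕ, 1 ≤ i → i ≤ n →
      (B ^ i) (tR n) =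
        SemidirectProduct.inl (((List.range i).map fun j => xg n (n + i - j)).prod)
          * tR n ∧
      (B ^ (n + i)) (tR n) = SemidirectProduct.inl (xg n i)⁻¹ * tR n := by
  have step : ∀ (m : ℕ) (h : Heis n),
      (B ^ m) (tR n) = SemidirectProduct.inl h * tR n →
      (B ^ (m + 1)) (tR n) = SemidirectProduct.inl (b h * xg n (n + 1)) * tR n := by
    intro m h hm
    rw [pow_succ', MulAut.mul_apply, hm, map_mul, hB.1, hB.2, map_mul, mul_assoc]
  have A : ∀ i, i ≤ n → (B ^ i) (tR n) = SemidirectProduct.inl (PP n i) * tR n := by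
    intro i
    induction i with
    | zero => intro _; simp [PP]
    | succ i ih =>
      intro hi
      rw [step i _ (ih (by omega)), b_PP n b hb i hi]
  have C : ∀ i, i + 1 ≤ n →
      (B ^ (n + (i + 1))) (tR n) = SemidirectProduct.inl (xg n (i + 1))⁻¹ * tR n := by
    intro i
    induction i with
    | zero =>
      intro _
      have h := step n _ (A n le_rfl)
      obtain ⟨m, rfl⟩ : ∃ m, n = m + 1 := ⟨n - 1, by omega⟩
      rw [PP_succ (m + 1) m, map_mul b, mul_assoc (b _) (b _), b_PP _ b hb m le_rfl,
        show m + 1 + m + 1 = 2 * (m + 1) by ring, hb.2.2, PP_inv, inv_mul_cancel_right] at h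
      exact h
    | succ i ih =>
      intro hi
      have h := step _ _ (ih (by omega))
      rw [map_inv, hb.1 (i + 1) (by omega) (by omega), xg_comm n (i + 1 + 1) (by omega) hi,
        mul_inv_rev, inv_mul_cancel_right] at h
      exact h
  intro i h1 h2
  refine ⟨A i h2, ?_⟩
  obtain ⟨m, rfl⟩ : ∃ m, i = m + 1 := ⟨i - 1, by omega⟩
  exact C m h2
end

section
/- Assume k = 2n+1 is prime. The set S_k = {B^j(t) : 0 ≤ j ≤ k−1} has exactly k elements, every element of S_k is an involution, and the subgroup of R_k generated by S_k is all of R_k. -/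
lemma xg_lo (n i : ℕ) (h : i < n) :
    xg n (i + 1) = ⟨fun l => if (l : ℕ) = i then 1 else 0, 0, 0⟩ := by
  unfold xg
  rw [dif_pos ⟨by omega, by omega⟩]
  ext l <;> simp [Pi.single_apply, Fin.ext_iff]

lemma xg_hi (n i : ℕ) (h : i < n) :
    xg n (n + 1 + i) = ⟨0, fun l => if (l : ℕ) = i then 1 else 0, 0⟩ := by
  unfold xg
  rw [dif_neg (by omega), dif_pos ⟨by omega, by omega⟩]
  ext l
  · simp
  · have : n + 1 + i - n - 1 = i := by omega
    simp [Pi.single_apply, Fin.ext_iff, this]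
  · simp

/-- First half of the translation parts. -/
def Yb (n j : ℕ) : Heis n := ⟨0, fun l => if (l : ℕ) < j then 1 else 0, 0⟩

lemma Yb_zero (n : ℕ) : Yb n 0 = 1 := by
  ext <;> simp [Yb]

lemma Yb_succ (n j : ℕ) (h : j < n) : Yb n (j + 1) = xg n (n + 1 + j) * Yb n j := by
  rw [xg_hi n j h]
  ext l
  · simp [Yb]
  · simp only [Yb, Heis.mul_b, Pi.add_apply]
    split_ifs <;> omega
  · simp [Yb]

lemma Yb_comm (n j m : ℕ) (h : j < n) :
    xg n (n + 1 + j) * Yb n m = Yb n m * xg n (n + 1 + j) := by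
  rw [xg_hi n j h]
  ext l <;> simp [Yb, add_comm]

lemma prod_eq (n m : ℕ) (h : m ≤ n) :
    ((List.range m).map fun j => (xg n (n + 1 + j))⁻¹).prod = (Yb n m)⁻¹ := by
  induction m with
  | zero => simp [Yb_zero]
  | succ m ih =>
    rw [List.range_succ, List.map_append, List.prod_append, ih (by omega),
      Yb_succ n m (by omega)]
    simp

lemma b_Yb (n : ℕ) (hn : 1 ≤ n) (b : MulAut (Heis n)) (hb : IsB n b) (j : ℕ) (h : j < n) :
    b (Yb n j) * xg n (n + 1) = Yb n (j + 1) := by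
  induction j with
  | zero => rw [Yb_succ n 0 h]; simp [Yb_zero]
  | succ j ih =>
    rw [Yb_succ n j (by omega), map_mul, mul_assoc, ih (by omega),
      hb.2.1 _ (by omega) (by omega), Yb_succ n (j + 1) h]
    rfl

lemma b_Yn (n : ℕ) (hn : 1 ≤ n) (b : MulAut (Heis n)) (hb : IsB n b) :
    b (Yb n n) * xg n (n + 1) = (xg n 1)⁻¹ := by
  obtain ⟨m, rfl⟩ : ∃ m, n = m + 1 := ⟨n - 1, by omega⟩
  have e : m + 1 + 1 + m = 2 * (m + 1) := by omega
  conv_lhs => rw [Yb_succ (m + 1) m (by omega), map_mul, mul_assoc,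
    b_Yb (m + 1) hn b hb m (by omega), e, hb.2.2, prod_eq _ _ le_rfl]
  simp

lemma b_x (n : ℕ) (b : MulAut (Heis n)) (hb : IsB n b) (i : ℕ) (h : i + 1 < n) :
    b (xg n (i + 1))⁻¹ * xg n (n + 1) = (xg n (i + 2))⁻¹ := by
  rw [map_inv, hb.1 _ (by omega) (by omega), mul_inv_rev]
  have hc : xg n (i + 2) * xg n (n + 1) = xg n (n + 1) * xg n (i + 2) := by
    rw [xg_lo n (i + 1) h, show xg n (n + 1) = xg n (n + 1 + 0) from rfl,
      xg_hi n 0 (by omega)]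
    ext l <;> simp [add_comm]
    refine Finset.sum_eq_zero fun x _ => ?_
    split_ifs <;> omega
  rw [show i + 1 + 1 = i + 2 from rfl, mul_assoc, inv_mul_eq_iff_eq_mul,
    inv_mul_eq_iff_eq_mul, ← mul_assoc, hc]
  simp

/-- The translation parts. -/
def Y (n j : ℕ) : Heis n := if j ≤ n then Yb n j else (xg n (j - n))⁻¹

lemma b_Y (n : ℕ) (hn : 1 ≤ n) (b : MulAut (Heis n)) (hb : IsB n b) (j : ℕ) (h : j < 2 * n) :
    b (Y n j) * xg n (n + 1) = Y n (j + 1) := by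
  unfold Y
  rcases lt_trichotomy j n with h1 | h1 | h1
  · rw [if_pos h1.le, if_pos (by omega), b_Yb n hn b hb j h1]
  · subst h1
    rw [if_pos le_rfl, if_neg (by omega), b_Yn _ hn b hb]
    simp
  · obtain ⟨i, rfl⟩ : ∃ i, j = n + (i + 1) := ⟨j - n - 1, by omega⟩
    rw [if_neg (by omega), if_neg (by omega), show n + (i + 1) - n = i + 1 by omega,
      show n + (i + 1) + 1 - n = i + 2 by omega, b_x n b hb i (by omega)]

lemma B_pow (n : ℕ) (hn : 1 ≤ n) (b : MulAut (Heis n)) (hb : IsB n b)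
    (B : MulAut (RR n)) (hB : IsBR n b B) (j : ℕ) (h : j ≤ 2 * n) :
    (B ^ j) (tR n) = SemidirectProduct.inl (Y n j) * tR n := by
  induction j with
  | zero => simp [Y, Yb_zero]
  | succ j ih =>
    rw [pow_succ', MulAut.mul_apply, ih (by omega), map_mul, hB.1, hB.2, ← mul_assoc,
      ← map_mul, b_Y n hn b hb j (by omega)]

lemma Y_inj (n i j : ℕ) (hij : i < j) (hj : j ≤ 2 * n) : Y n i ≠ Y n j := by
  intro h
  unfold Y at h
  by_cases h1 : j ≤ n
  · rw [if_pos (by omega), if_pos h1] at h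
    have := congrFun (congrArg Heis.b h) ⟨i, by omega⟩
    simp [Yb, hij] at this
  · obtain ⟨m, rfl⟩ : ∃ m, j = n + (m + 1) := ⟨j - n - 1, by omega⟩
    rw [if_neg h1, show n + (m + 1) - n = m + 1 by omega, xg_lo n m (by omega)] at h
    have := congrFun (congrArg Heis.a h) ⟨m, by omega⟩
    split_ifs at this with h2
    · simp [Yb] at this
    · obtain ⟨p, rfl⟩ : ∃ p, i = n + (p + 1) := ⟨i - n - 1, by omega⟩
      rw [show n + (p + 1) - n = p + 1 by omega, xg_lo n p (by omega)] at this
      simp at this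
      omega

lemma tAut_sq (n : ℕ) : tAut n ^ 2 = 1 := by
  rw [pow_two]
  ext g <;> simp [tAut]

lemma tAut_ne (n : ℕ) (hn : 1 ≤ n) : tAut n ≠ 1 := by
  intro h
  have := congrArg (fun f : MulAut (Heis n) => (f ⟨fun _ => 1, 0, 0⟩).a ⟨0, by omega⟩) h
  simp [tAut] at this

lemma orderOf_tR (n : ℕ) (hn : 1 ≤ n) : orderOf (tR n) = 2 := by
  unfold tR
  rw [orderOf_injective _ SemidirectProduct.inr_injective, ← Subgroup.orderOf_coe]
  exact orderOf_eq_prime (tAut_sq n) (tAut_ne n hn)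

lemma heis_top (n : ℕ) (hn : 1 ≤ n) (K : Subgroup (Heis n))
    (h1 : ∀ i < n, xg n (i + 1) ∈ K) (h2 : ∀ i < n, xg n (n + 1 + i) ∈ K) (g : Heis n) :
    g ∈ K := by
  let A : AddSubgroup (Fin n → ℤ) :=
    { carrier := {a | (⟨a, 0, 0⟩ : Heis n) ∈ K}
      zero_mem' := K.one_mem
      add_mem' := fun {x y} hx hy => by
        have := K.mul_mem hx hy
        have e : (⟨x, 0, 0⟩ : Heis n) * ⟨y, 0, 0⟩ = ⟨x + y, 0, 0⟩ := by ext <;> simp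
        rwa [e] at this
      neg_mem' := fun {x} hx => by
        have := K.inv_mem hx
        have e : (⟨x, 0, 0⟩ : Heis n)⁻¹ = ⟨-x, 0, 0⟩ := by ext <;> simp
        rwa [e] at this }
  let A' : AddSubgroup (Fin n → ℤ) :=
    { carrier := {a | (⟨0, a, 0⟩ : Heis n) ∈ K}
      zero_mem' := K.one_mem
      add_mem' := fun {x y} hx hy => by
        have := K.mul_mem hx hy
        have e : (⟨0, x, 0⟩ : Heis n) * ⟨0, y, 0⟩ = ⟨0, x + y, 0⟩ := by ext <;> simp
        rwa [e] at this
      neg_mem' := fun {x} hx => by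
        have := K.inv_mem hx
        have e : (⟨0, x, 0⟩ : Heis n)⁻¹ = ⟨0, -x, 0⟩ := by ext <;> simp
        rwa [e] at this }
  let C : AddSubgroup ℤ :=
    { carrier := {c | (⟨0, 0, c⟩ : Heis n) ∈ K}
      zero_mem' := K.one_mem
      add_mem' := fun {x y} hx hy => by
        have := K.mul_mem hx hy
        have e : (⟨0, 0, x⟩ : Heis n) * ⟨0, 0, y⟩ = ⟨0, 0, x + y⟩ := by ext <;> simp
        rwa [e] at this
      neg_mem' := fun {x} hx => by
        have := K.inv_mem hx
        have e : (⟨0, 0, x⟩ : Heis n)⁻¹ = ⟨0, 0, -x⟩ := by ext <;> simp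
        rwa [e] at this }
  have key : ∀ (D : AddSubgroup (Fin n → ℤ)),
      (∀ i < n, (fun l : Fin n => if (l : ℕ) = i then (1 : ℤ) else 0) ∈ D) → ∀ a, a ∈ D := by
    intro D hD a
    have : a = ∑ i : Fin n, a i • (fun l : Fin n => if (l : ℕ) = i then (1 : ℤ) else 0) := by
      ext l
      simp [Finset.sum_apply, ← Fin.ext_iff]
    rw [this]
    exact sum_mem fun i _ => D.zsmul_mem (hD i i.2) _
  have hA : ∀ a, a ∈ A := key A fun i hi => by
    have := h1 i hi
    rwa [xg_lo n i hi] at this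
  have hA' : ∀ a, a ∈ A' := key A' fun i hi => by
    have := h2 i hi
    rwa [xg_hi n i hi] at this
  have hC1 : (1 : ℤ) ∈ C := by
    change (⟨0, 0, 1⟩ : Heis n) ∈ K
    have h3 := h1 0 (by omega)
    have h4 := h2 0 (by omega)
    have := K.mul_mem (K.inv_mem (K.mul_mem h4 h3)) (K.mul_mem h3 h4)
    rw [xg_lo n 0 (by omega), xg_hi n 0 (by omega)] at this
    convert this using 1
    obtain ⟨m, rfl⟩ : ∃ m, n = m + 1 := ⟨n - 1, by omega⟩
    ext l
    · simp
    · simp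
    · simp [Fin.sum_univ_succ]
  have hC : ∀ c, c ∈ C := fun c => by
    have := C.zsmul_mem hC1 c
    simpa using this
  have e : g = ⟨0, g.b, 0⟩ * ⟨g.a, 0, 0⟩ * ⟨0, 0, g.c⟩ := by ext <;> simp
  rw [e]
  exact K.mul_mem (K.mul_mem (hA' _) (hA _)) (hC _)

/-- Assume `k = 2n+1` is prime. The set `S_k = {B^j(t) : 0 ≤ j ≤ k-1}` has
exactly `k` elements, every element of `S_k` is an involution, and `S_k`
generates `R_k`. -/
theorem Sk_properties (n k : ℕ) (hn : 1 ≤ n) (hk : k = 2 * n + 1)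
    (hp : Nat.Prime k) (b : MulAut (Heis n)) (hb : IsB n b)
    (B : MulAut (RR n)) (hB : IsBR n b B)
    (S : Set (RR n)) (hS : S = (fun j : ℕ => (B ^ j) (tR n)) '' Set.Iio k) :
    S.ncard = k ∧ (∀ s ∈ S, orderOf s = 2) ∧ Subgroup.closure S = ⊤ := by
  subst hk
  have hf : ∀ j, j < 2 * n + 1 → (B ^ j) (tR n) = SemidirectProduct.inl (Y n j) * tR n :=
    fun j hj => B_pow n hn b hb B hB j (by omega)
  refine ⟨?_, ?_, ?_⟩
  · rw [hS, Set.InjOn.ncard_image, ← Nat.card_coe_set_eq]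
    · simp
    · intro i hi j hj h
      simp only [Set.mem_Iio] at hi hj
      simp only at h
      rw [hf i hi, hf j hj] at h
      have h := SemidirectProduct.inl_injective (mul_right_cancel h)
      by_contra hne
      rcases lt_or_gt_of_ne hne with h3 | h3
      · exact Y_inj n i j h3 (by omega) h
      · exact Y_inj n j i h3 (by omega) h.symm
  · rw [hS]
    rintro s ⟨j, -, rfl⟩
    change orderOf ((B ^ j) (tR n)) = 2
    rw [MulEquiv.orderOf_eq, orderOf_tR n hn]
  · have hmem : ∀ j, j < 2 * n + 1 →
        SemidirectProduct.inl (Y n j) * tR n ∈ Subgroup.closure S := fun j hj => by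
      apply Subgroup.subset_closure
      rw [hS]
      exact ⟨j, hj, hf j hj⟩
    have ht : tR n ∈ Subgroup.closure S := by
      simpa [Y, Yb_zero] using hmem 0 (by omega)
    have hY : ∀ j, j < 2 * n + 1 →
        Y n j ∈ (Subgroup.closure S).comap SemidirectProduct.inl := fun j hj =>
      (Subgroup.mul_mem_cancel_right _ ht).1 (hmem j hj)
    have hH := heis_top n hn ((Subgroup.closure S).comap SemidirectProduct.inl) (by
      intro i hi
      have := hY (n + (i + 1)) (by omega)
      unfold Y at this
      rw [if_neg (by omega), show n + (i + 1) - n = i + 1 by omega] at this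
      exact inv_mem_iff.1 this) (by
      intro i hi
      have h1 := hY (i + 1) (by omega)
      have h2 := hY i (by omega)
      unfold Y at h1 h2
      rw [if_pos (by omega)] at h1 h2
      rw [Yb_succ n i hi] at h1
      exact (Subgroup.mul_mem_cancel_right _ h2).1 h1)
    rw [eq_top_iff]
    rintro g -
    rw [← SemidirectProduct.inl_left_mul_inr_right g]
    refine Subgroup.mul_mem _ (hH g.left) ?_
    obtain ⟨m, hm⟩ := Subgroup.mem_zpowers_iff.1 g.right.2
    have e : g.right = (⟨tAut n, Subgroup.mem_zpowers _⟩ : tsub n) ^ m := by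
      ext1
      simp [hm]
    rw [e, map_zpow]
    exact Subgroup.zpow_mem _ ht m
end

section
/- Assume k = 2n+1 is prime. The set P_k = {b^j(x_{n+1}) : 0 ≤ j ≤ k−1} has exactly k elements, the subgroup of H_k generated by P_k is all of H_k, and no element of P_k is the inverse of an element of P_k (i.e., for all s, s' ∈ P_k, s·s' ≠ 1). -/
lemma xg_lo_s8 (n i : ℕ) (h : i < n) : xg n (i + 1) = ⟨Pi.single (⟨i, h⟩ : Fin n) 1, 0, 0⟩ := by
  have : 1 ≤ i + 1 ∧ i + 1 ≤ n := by omega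
  simp [xg, this]

lemma xg_hi_s8 (n i : ℕ) (h : i < n) : xg n (n + 1 + i) = ⟨0, Pi.single (⟨i, h⟩ : Fin n) 1, 0⟩ := by
  have h1 : ¬ (1 ≤ n + 1 + i ∧ n + 1 + i ≤ n) := by omega
  have h2 : n + 1 ≤ n + 1 + i ∧ n + 1 + i ≤ 2 * n := by omega
  have h3 : n + 1 + i - n - 1 = i := by omega
  unfold xg
  rw [dif_neg h1, dif_pos h2]
  simp only [h3]

def linF (n k : ℕ) (u v : ℕ → ZMod k) : Heis n →* Multiplicative (ZMod k) where
  toFun g := Multiplicative.ofAdd (∑ i : Fin n, (u i * (g.a i : ZMod k) + v i * (g.b i : ZMod k)))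
  map_one' := by simp
  map_mul' g h := by
    rw [← ofAdd_add, ← Finset.sum_add_distrib]
    congr 1
    apply Finset.sum_congr rfl
    intro i _
    simp
    ring

lemma linF_lo (n k : ℕ) (u v : ℕ → ZMod k) (i : ℕ) (h : i < n) :
    linF n k u v (xg n (i + 1)) = Multiplicative.ofAdd (u i) := by
  rw [xg_lo_s8 n i h]
  simp only [linF, MonoidHom.coe_mk, OneHom.coe_mk]
  congr 1
  rw [Finset.sum_eq_single (⟨i, h⟩ : Fin n)]
  · simp
  · intro j _ hj
    simp [hj]
  · simp

lemma linF_hi (n k : ℕ) (u v : ℕ → ZMod k) (i : ℕ) (h : i < n) :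
    linF n k u v (xg n (n + 1 + i)) = Multiplicative.ofAdd (v i) := by
  rw [xg_hi_s8 n i h]
  simp only [linF, MonoidHom.coe_mk, OneHom.coe_mk]
  congr 1
  rw [Finset.sum_eq_single (⟨i, h⟩ : Fin n)]
  · simp
  · intro j _ hj
    simp [hj]
  · simp

lemma linF_prod (n k : ℕ) (u v : ℕ → ZMod k) (m : ℕ) (h : m ≤ n) :
    linF n k u v ((List.range m).map fun j => (xg n (n + 1 + j))⁻¹).prod
      = Multiplicative.ofAdd (- ∑ j ∈ Finset.range m, v j) := by
  induction m with
  | zero => simp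
  | succ m ih =>
    rw [List.range_succ, List.map_append, List.prod_append, map_mul, ih (by omega),
      Finset.sum_range_succ, List.map_singleton, List.prod_singleton, map_inv,
      linF_hi n k u v m (by omega), ← ofAdd_neg, ← ofAdd_add]
    congr 1
    ring

lemma top_of_gens (n : ℕ) (hn : 1 ≤ n) (K : Subgroup (Heis n))
    (h1 : ∀ i, i < n → xg n (i + 1) ∈ K) (h2 : ∀ i, i < n → xg n (n + 1 + i) ∈ K) : K = ⊤ := by
  have hA : ∀ a : Fin n → ℤ, (⟨a, 0, 0⟩ : Heis n) ∈ K := by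
    let S : AddSubgroup (Fin n → ℤ) :=
      { carrier := {a | (⟨a, 0, 0⟩ : Heis n) ∈ K}
        zero_mem' := K.one_mem
        add_mem' := by
          intro x y hx hy
          have := K.mul_mem hx hy
          have e : (⟨x, 0, 0⟩ : Heis n) * ⟨y, 0, 0⟩ = ⟨x + y, 0, 0⟩ := by ext <;> simp
          rw [e] at this
          exact this
        neg_mem' := by
          intro x hx
          have := K.inv_mem hx
          have e : (⟨x, 0, 0⟩ : Heis n)⁻¹ = ⟨-x, 0, 0⟩ := by ext <;> simp
          rw [e] at this
          exact this }
    intro a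
    change a ∈ S
    rw [← Finset.univ_sum_single a]
    refine S.sum_mem fun i _ => ?_
    have : Pi.single i (a i) = a i • (Pi.single i 1 : Fin n → ℤ) := by
      rw [← Pi.single_smul]; simp
    rw [this]
    refine S.zsmul_mem ?_ _
    have := h1 i i.2
    rw [xg_lo_s8 n i i.2] at this
    exact this
  have hB : ∀ a : Fin n → ℤ, (⟨0, a, 0⟩ : Heis n) ∈ K := by
    let S : AddSubgroup (Fin n → ℤ) :=
      { carrier := {a | (⟨0, a, 0⟩ : Heis n) ∈ K}
        zero_mem' := K.one_mem
        add_mem' := by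
          intro x y hx hy
          have := K.mul_mem hx hy
          have e : (⟨0, x, 0⟩ : Heis n) * ⟨0, y, 0⟩ = ⟨0, x + y, 0⟩ := by ext <;> simp
          rw [e] at this
          exact this
        neg_mem' := by
          intro x hx
          have := K.inv_mem hx
          have e : (⟨0, x, 0⟩ : Heis n)⁻¹ = ⟨0, -x, 0⟩ := by ext <;> simp
          rw [e] at this
          exact this }
    intro a
    change a ∈ S
    rw [← Finset.univ_sum_single a]
    refine S.sum_mem fun i _ => ?_
    have : Pi.single i (a i) = a i • (Pi.single i 1 : Fin n → ℤ) := by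
      rw [← Pi.single_smul]; simp
    rw [this]
    refine S.zsmul_mem ?_ _
    have := h2 i i.2
    rw [xg_hi_s8 n i i.2] at this
    exact this
  rw [eq_top_iff]
  intro g _
  let i0 : Fin n := ⟨0, hn⟩
  -- (a',0,0)(0,f,0) = (a', f, a' 0)
  have e : g = ⟨0, g.b - Pi.single i0 1, 0⟩ * ⟨Pi.single i0 g.c, 0, 0⟩ * ⟨0, Pi.single i0 1, 0⟩ *
      ⟨g.a - Pi.single i0 g.c, 0, 0⟩ := by
    ext <;> simp [Pi.single_apply]
  rw [e]
  exact K.mul_mem (K.mul_mem (K.mul_mem (hB _) (hA _)) (hB _)) (hA _)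

lemma hom_ext' {n : ℕ} (hn : 1 ≤ n) {M : Type*} [CommGroup M] (f g : Heis n →* M)
    (h1 : ∀ i, i < n → f (xg n (i + 1)) = g (xg n (i + 1)))
    (h2 : ∀ i, i < n → f (xg n (n + 1 + i)) = g (xg n (n + 1 + i))) : f = g := by
  have := top_of_gens n hn (f.eqLocus g) h1 h2
  ext x
  have hx : x ∈ f.eqLocus g := by rw [this]; trivial
  exact hx

lemma linF_comp (n k : ℕ) (hn : 1 ≤ n) (b : MulAut (Heis n)) (hb : IsB n b)
    (u v u' v' : ℕ → ZMod k)
    (c1 : ∀ i, i + 1 < n → u (i + 1) + v 0 = u' i)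
    (c2 : v 0 = u' (n - 1))
    (c3 : ∀ i, i + 1 < n → v (i + 1) = v' i)
    (c4 : - u 0 - ∑ j ∈ Finset.range n, v j = v' (n - 1)) (g : Heis n) :
    linF n k u v (b g) = linF n k u' v' g := by
  obtain ⟨b1, b2, b3⟩ := hb
  have : (linF n k u v).comp b.toMonoidHom = linF n k u' v' := by
    apply hom_ext' hn
    · intro i hi
      change linF n k u v (b _) = _
      rw [linF_lo _ _ _ _ i hi]
      by_cases h : i + 1 < n
      · rw [b1 (i + 1) (by omega) (by omega), map_mul, linF_lo _ _ _ _ (i + 1) h,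
          show n + 1 = n + 1 + 0 from rfl, linF_hi _ _ _ _ 0 (by omega), ← ofAdd_add, c1 i h]
      · obtain rfl : n = i + 1 := by omega
        rw [b2 (i + 1) (by omega) (by omega)]
        have := linF_hi (i + 1) k u v 0 (by omega)
        rw [add_zero] at this
        rw [this, c2]
        simp
    · intro i hi
      change linF n k u v (b _) = _
      rw [linF_hi _ _ _ _ i hi]
      by_cases h : i + 1 < n
      · rw [b2 (n + 1 + i) (by omega) (by omega), add_assoc (n + 1),
          linF_hi _ _ _ _ (i + 1) h, c3 i h]
      · have e : n + 1 + i = 2 * n := by omega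
        have e2 : i = n - 1 := by omega
        rw [e, b3, map_mul, map_inv, linF_prod _ _ _ _ n le_rfl,
          show 1 = 0 + 1 from rfl, linF_lo _ _ _ _ 0 (by omega), e2, ← c4, ← ofAdd_neg, ← ofAdd_add,
          sub_eq_add_neg]
  exact DFunLike.congr_fun this g

lemma gens_mem (n : ℕ) (hn : 1 ≤ n) (b : MulAut (Heis n)) (hb : IsB n b) :
    Subgroup.closure ((fun j : ℕ => (b ^ j) (xg n (n + 1))) '' Set.Iio (2 * n + 1)) = ⊤ := by
  obtain ⟨b1, b2, b3⟩ := hb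
  set y : ℕ → Heis n := fun j => (b ^ j) (xg n (n + 1)) with hy
  have ys : ∀ j, y (j + 1) = b (y j) := by
    intro j
    simp [hy, pow_succ']
  let K : ℕ → Subgroup (Heis n) := fun m => Subgroup.closure (y '' Set.Iio m)
  have ymem : ∀ j m, j < m → y j ∈ K m := fun j m h =>
    Subgroup.subset_closure ⟨j, h, rfl⟩
  have Kmono : ∀ l m, l ≤ m → K l ≤ K m := fun l m h =>
    Subgroup.closure_mono (Set.image_mono (Set.Iio_subset_Iio h))
  have Kb : ∀ m x, x ∈ K m → b x ∈ K (m + 1) := by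
    intro m
    have : K m ≤ (K (m + 1)).comap b.toMonoidHom := by
      rw [Subgroup.closure_le]
      rintro _ ⟨j, hj, rfl⟩
      change b (y j) ∈ K (m + 1)
      rw [← ys]
      exact ymem _ _ (by simpa using hj)
    exact fun x hx => this hx
  have yx : ∀ j, j < n → y j = xg n (n + 1 + j) := by
    intro j
    induction j with
    | zero => intro _; simp [hy]
    | succ j ih =>
      intro h
      rw [ys, ih (by omega), b2 _ (by omega) (by omega)]
      rfl
  have x1 : xg n 1 ∈ K (n + 1) := by
    have hL : ((List.range n).map fun j => (xg n (n + 1 + j))⁻¹).prod ∈ K (n + 1) := by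
      apply Subgroup.list_prod_mem
      intro x hx
      simp only [List.mem_map, List.mem_range] at hx
      obtain ⟨j, hj, rfl⟩ := hx
      rw [← yx j hj]
      exact (K (n + 1)).inv_mem (ymem _ _ (by omega))
    have hyn : y n = (xg n 1)⁻¹ * ((List.range n).map fun j => (xg n (n + 1 + j))⁻¹).prod := by
      rw [← b3]
      have := ys (n - 1)
      rw [yx (n - 1) (by omega), Nat.sub_add_cancel hn] at this
      rw [this]
      congr 2
      omega
    have := ymem n (n + 1) (by omega)
    rw [hyn, Subgroup.mul_mem_cancel_right _ hL, Subgroup.inv_mem_iff] at this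
    exact this
  have xi : ∀ i, i < n → xg n (i + 1) ∈ K (n + 1 + i) := by
    intro i
    induction i with
    | zero => intro _; exact x1
    | succ i ih =>
      intro h
      have := Kb _ _ (ih (by omega))
      rw [b1 _ (by omega) (by omega), Subgroup.mul_mem_cancel_right] at this
      · exact this
      · have h0 := ymem 0 (n + 1 + i + 1) (by omega)
        rwa [yx 0 (by omega)] at h0
  apply top_of_gens n hn
  · intro i hi
    exact Kmono _ _ (by omega) (xi i hi)
  · intro i hi
    rw [← yx i hi]
    exact ymem _ _ (by omega)

theorem Pk_properties (n k : ℕ) (hn : 1 ≤ n) (hk : k = 2 * n + 1)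
    (hp : Nat.Prime k) (b : MulAut (Heis n)) (hb : IsB n b)
    (P : Set (Heis n))
    (hP : P = (fun j : ℕ => (b ^ j) (xg n (n + 1))) '' Set.Iio k) :
    P.ncard = k ∧ Subgroup.closure P = ⊤ ∧
      ∀ s ∈ P, ∀ s' ∈ P, s * s' ≠ 1 := by
  have hk0 : (2 * n + 1 : ZMod k) = 0 := by
    have := ZMod.natCast_self k
    rw [← this, hk]; push_cast; rfl
  -- psi
  let u : ℕ → ZMod k := fun i => ((n - i : ℕ) : ZMod k)
  let v : ℕ → ZMod k := fun _ => 1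
  let u2 : ℕ → ZMod k := fun i => -((n - i + 1).choose 2 : ℕ)
  let v2 : ℕ → ZMod k := fun i => (i : ZMod k)
  have hpsi : ∀ g, linF n k u v (b g) = linF n k u v g := by
    apply linF_comp n k hn b hb
    · intro i hi
      simp only [u, v]
      rw [show n - i = n - (i + 1) + 1 by omega]
      push_cast; rfl
    · simp only [u, v]
      rw [show n - (n - 1) = 1 by omega]
      simp
    · intros; rfl
    · simp only [u, v]
      simp
      linear_combination -hk0
  have hphi : ∀ g, linF n k u2 v2 (b g) = linF n k (fun i => u2 i + u i) (fun i => v2 i + v i) g := by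
    apply linF_comp n k hn b hb
    · intro i hi
      simp only [u, u2, v2]
      rw [show n - i = n - (i + 1) + 1 by omega, Nat.choose_succ_succ' (n - (i + 1) + 1) 1]
      push_cast [Nat.choose_one_right]; ring
    · simp only [u, u2, v2]
      rw [show n - (n - 1) = 1 by omega]
      simp
    · intros; simp [v, v2]
    · simp only [u2, v, v2]
      rw [← Nat.cast_sum, Finset.sum_range_id, ← Nat.choose_two_right, Nat.sub_zero,
        Nat.choose_succ_succ' n 1]
      push_cast [Nat.choose_one_right, Nat.cast_sub hn]; ring
  have hadd : ∀ g, linF n k (fun i => u2 i + u i) (fun i => v2 i + v i) g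
      = linF n k u2 v2 g * linF n k u v g := by
    intro g
    simp only [linF, MonoidHom.coe_mk, OneHom.coe_mk]
    rw [← ofAdd_add, ← Finset.sum_add_distrib]
    congr 1
    apply Finset.sum_congr rfl
    intros; ring
  have p1 : ∀ j : ℕ, linF n k u v ((b ^ j) (xg n (n + 1))) = Multiplicative.ofAdd 1 := by
    intro j
    induction j with
    | zero => exact linF_hi n k u v 0 (by omega)
    | succ j ih => rw [pow_succ', MulAut.mul_apply, hpsi, ih]
  have p2 : ∀ j : ℕ, linF n k u2 v2 ((b ^ j) (xg n (n + 1))) = Multiplicative.ofAdd (j : ZMod k) := by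
    intro j
    induction j with
    | zero => exact linF_hi n k u2 v2 0 (by omega)
    | succ j ih =>
      rw [pow_succ', MulAut.mul_apply, hphi, hadd, ih, p1, ← ofAdd_add]
      push_cast; rfl
  refine ⟨?_, ?_, ?_⟩
  · rw [hP, Set.ncard_image_of_injOn]
    · rw [← Finset.coe_Iio, Set.ncard_coe_finset]; simp
    · intro i hi j hj hij
      have h := congrArg (linF n k u2 v2) hij
      simp only [p2] at h
      have h' : (i : ZMod k) = j := Multiplicative.ofAdd.injective h
      rw [ZMod.natCast_eq_natCast_iff] at h'
      exact Nat.ModEq.eq_of_lt_of_lt h' hi hj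
  · rw [hP, hk]
    exact gens_mem n hn b hb
  · rw [hP]
    rintro _ ⟨i, hi, rfl⟩ _ ⟨j, hj, rfl⟩ h
    have h := congrArg (linF n k u v) h
    simp only [map_mul, p1, map_one] at h
    rw [← ofAdd_add] at h
    have h' : (1 + 1 : ZMod k) = 0 := Multiplicative.ofAdd.injective h
    have h2 : ((2 : ℕ) : ZMod k) = 0 := by push_cast; rw [← h']; norm_num
    rw [ZMod.natCast_eq_zero_iff] at h2
    have := Nat.le_of_dvd (by norm_num) h2
    omega
end
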